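/- arXiv:math-ph/0604063 — 6 statements merged into one kernel-verified Lean document; each statement's English description precedes it below -/
import Mathlib

section
/- Let H : ℝⁿ × ℝⁿ → ℝ be continuously differentiable and a : ℝⁿ → ℝⁿ be continuously differentiable, and define the vector field X : ℝⁿ → ℝⁿ by X(q) = (∂H/∂p)(q, a(q)). Assume that through every point q ∈ ℝⁿ there passes a solution of γ' = X ∘ γ defined on an open interval around 0 with γ(0) = q. Then the following are equivalent: (i) for every solution γ : I → ℝⁿ of γ'(t) = X(γ(t)), the curve μ(t) = (γ(t), a(γ(t))) is a solution of Hamilton's equations, i.e. γ'(t) = (∂H/∂p)(μ(t)) and d/dt[a(γ(t))] = −(∂H/∂q)(μ(t)) for all t; (ii) for every q ∈ ℝⁿ and every index i, Σ_j (∂a_i/∂q^j)(q) · (∂H/∂p_j)(q, a(q)) + (∂H/∂q^i)(q, a(q)) = 0. -/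
open Set

/-- Let `H : ℝⁿ × ℝⁿ → ℝ` and `a : ℝⁿ → ℝⁿ` be `C¹`, and let
`X(q) = (∂H/∂p)(q, a(q))`. Assume local solutions of `γ' = X ∘ γ` exist through every point.
Then every solution `γ` of `γ' = X ∘ γ` gives a solution `μ(t) = (γ(t), a(γ(t)))` of
Hamilton's equations if and only if, for all `q` and `i`,
`Σ_j (∂aᵢ/∂qʲ)(q)·(∂H/∂pⱼ)(q, a(q)) + (∂H/∂qⁱ)(q, a(q)) = 0`
(the generalized Hamiltonian Hamilton–Jacobi equation). -/
theorem stmt8 {n : ℕ}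
    (H : (Fin n → ℝ) × (Fin n → ℝ) → ℝ) (hH : ContDiff ℝ 1 H)
    (a : (Fin n → ℝ) → (Fin n → ℝ)) (ha : ContDiff ℝ 1 a)
    (X : (Fin n → ℝ) → (Fin n → ℝ))
    (hX : ∀ q i, X q i = fderiv ℝ H (q, a q) (0, Pi.single i 1))
    (hexist : ∀ q : Fin n → ℝ, ∃ (γ : ℝ → (Fin n → ℝ)) (ε : ℝ), 0 < ε ∧ γ 0 = q ∧
      ∀ t ∈ Set.Ioo (-ε) ε, HasDerivAt γ (X (γ t)) t) :
    (∀ (γ : ℝ → (Fin n → ℝ)) (c d : ℝ),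
      (∀ t ∈ Set.Ioo c d, HasDerivAt γ (X (γ t)) t) →
      ∀ t ∈ Set.Ioo c d,
        HasDerivAt γ (fun i => fderiv ℝ H (γ t, a (γ t)) (0, Pi.single i 1)) t ∧
        HasDerivAt (fun s => a (γ s))
          (fun i => -(fderiv ℝ H (γ t, a (γ t)) (Pi.single i 1, 0))) t)
      ↔
    (∀ (q : Fin n → ℝ) (i : Fin n),
      (∑ j : Fin n,
        fderiv ℝ (fun q' => a q' i) q (Pi.single j 1) *
          fderiv ℝ H (q, a q) (0, Pi.single j 1)) +
        fderiv ℝ H (q, a q) (Pi.single i 1, 0) = 0) := by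
  have hda : Differentiable ℝ a := ha.differentiable (by norm_num)
  have key : ∀ q i, (∑ j : Fin n, fderiv ℝ (fun q' => a q' i) q (Pi.single j 1) *
      fderiv ℝ H (q, a q) (0, Pi.single j 1)) = fderiv ℝ a q (X q) i := by
    intro q i
    have h1 : HasFDerivAt (fun q' => a q' i)
        ((ContinuousLinearMap.proj (R := ℝ) (φ := fun _ : Fin n => ℝ) i).comp
          (fderiv ℝ a q)) q :=
      (hasFDerivAt_pi'.1 (hda q).hasFDerivAt) i
    have h2 : X q = ∑ j : Fin n, X q j • (Pi.single j (1 : ℝ) : Fin n → ℝ) :=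
      pi_eq_sum_univ' (X q)
    rw [h1.fderiv]
    conv_rhs => rw [h2]
    rw [map_sum, Finset.sum_apply]
    refine Finset.sum_congr rfl fun j _ => ?_
    rw [map_smul, Pi.smul_apply, smul_eq_mul, hX, mul_comm]
    rfl
  have chain : ∀ (γ : ℝ → (Fin n → ℝ)) (t : ℝ), HasDerivAt γ (X (γ t)) t →
      HasDerivAt (fun s => a (γ s)) (fderiv ℝ a (γ t) (X (γ t))) t := by
    intro γ t h
    exact (hda (γ t)).hasFDerivAt.comp_hasDerivAt t h
  constructor
  · intro h q i
    obtain ⟨γ, ε, hε, h0, hγ⟩ := hexist q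
    have hm : (0 : ℝ) ∈ Set.Ioo (-ε) ε := ⟨by linarith, hε⟩
    have h1 := (h γ (-ε) ε hγ 0 hm).2
    have h2 := chain γ 0 (hγ 0 hm)
    have h3 := congrFun (h1.unique h2) i
    simp only [h0] at h3
    rw [key, ← h3]
    ring
  · intro h γ c d hγ t ht
    constructor
    · have e : X (γ t) = fun i => fderiv ℝ H (γ t, a (γ t)) (0, Pi.single i 1) :=
        funext (hX (γ t))
      rw [← e]
      exact hγ t ht
    · have e : fderiv ℝ a (γ t) (X (γ t)) =
          fun i => -(fderiv ℝ H (γ t, a (γ t)) (Pi.single i 1, 0)) := by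
        funext i
        have := h (γ t) i
        rw [key] at this
        linarith
      rw [← e]
      exact chain γ t (hγ t ht)
end

section
/- Let L : ℝⁿ × ℝⁿ → ℝ be twice continuously differentiable (coordinates (q, v)) and w : ℝⁿ → ℝⁿ continuously differentiable, and assume that through every point q ∈ ℝⁿ there passes a solution of γ' = w ∘ γ defined on an open interval around 0 with γ(0) = q. Then the following are equivalent: (i) every solution γ : I → ℝⁿ of γ'(t) = w(γ(t)) satisfies the Euler–Lagrange equations: for each i, the function t ↦ (∂L/∂v^i)(γ(t), γ'(t)) is differentiable with derivative (∂L/∂q^i)(γ(t), γ'(t)); (ii) for every q ∈ ℝⁿ and every index i, Σ_{j,k} (∂²L/∂v^i∂v^j)(q, w(q)) · (∂w^j/∂q^k)(q) · w^k(q) + Σ_j (∂²L/∂v^i∂q^j)(q, w(q)) · w^j(q) − (∂L/∂q^i)(q, w(q)) = 0. -/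
open Set

theorem lin_expand {n : ℕ} (A : (Fin n → ℝ) →L[ℝ] ℝ) (u : Fin n → ℝ) :
    A u = ∑ j : Fin n, A (Pi.single j 1) * u j := by
  have h := A.toLinearMap.pi_apply_eq_sum_univ u
  simp only [ContinuousLinearMap.coe_coe] at h
  rw [h]
  refine Finset.sum_congr rfl fun j _ => ?_
  rw [smul_eq_mul, mul_comm]
  congr 2
  ext k
  simp [Pi.single_apply, eq_comm]

theorem lin_expand_prod {n : ℕ} (A : (Fin n → ℝ) × (Fin n → ℝ) →L[ℝ] ℝ) (u v : Fin n → ℝ) :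
    A (u, v) = (∑ j : Fin n, A (0, Pi.single j 1) * v j)
      + ∑ j : Fin n, A (Pi.single j 1, 0) * u j := by
  have h1 := lin_expand (A.comp (ContinuousLinearMap.inl ℝ _ _)) u
  have h2 := lin_expand (A.comp (ContinuousLinearMap.inr ℝ _ _)) v
  simp only [ContinuousLinearMap.comp_apply, ContinuousLinearMap.inl_apply,
    ContinuousLinearMap.inr_apply] at h1 h2
  rw [← h1, ← h2, ← map_add]
  simp

/-- Let `L : ℝⁿ × ℝⁿ → ℝ` (coordinates `(q, v)`) be `C²` and
`w : ℝⁿ → ℝⁿ` be `C¹`, and assume local solutions of `γ' = w ∘ γ` exist through every point.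
Then every solution of `γ' = w ∘ γ` satisfies the Euler–Lagrange equations if and only if,
for all `q` and `i`,
`Σ_{j,k} (∂²L/∂vⁱ∂vʲ)(q,w(q))·(∂wʲ/∂qᵏ)(q)·wᵏ(q) + Σ_j (∂²L/∂vⁱ∂qʲ)(q,w(q))·wʲ(q)
  − (∂L/∂qⁱ)(q,w(q)) = 0`
(the generalized Lagrangian Hamilton–Jacobi equation in coordinates). -/
theorem stmt9 {n : ℕ}
    (L : (Fin n → ℝ) × (Fin n → ℝ) → ℝ) (hL : ContDiff ℝ 2 L)
    (w : (Fin n → ℝ) → (Fin n → ℝ)) (hw : ContDiff ℝ 1 w)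
    (hexist : ∀ q : Fin n → ℝ, ∃ (γ : ℝ → (Fin n → ℝ)) (ε : ℝ), 0 < ε ∧ γ 0 = q ∧
      ∀ t ∈ Set.Ioo (-ε) ε, HasDerivAt γ (w (γ t)) t) :
    (∀ (γ : ℝ → (Fin n → ℝ)) (c d : ℝ),
      (∀ t ∈ Set.Ioo c d, HasDerivAt γ (w (γ t)) t) →
      ∀ t ∈ Set.Ioo c d, ∀ i : Fin n,
        -- `d/dt[(∂L/∂vⁱ)(γ(t), γ'(t))] = (∂L/∂qⁱ)(γ(t), γ'(t))`, with `γ' = w ∘ γ`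
        HasDerivAt (fun s => fderiv ℝ L (γ s, w (γ s)) (0, Pi.single i 1))
          (fderiv ℝ L (γ t, w (γ t)) (Pi.single i 1, 0)) t)
      ↔
    (∀ (q : Fin n → ℝ) (i : Fin n),
      (∑ j : Fin n, ∑ k : Fin n,
        fderiv ℝ (fun x => fderiv ℝ L x (0, Pi.single i 1)) (q, w q) (0, Pi.single j 1) *
          fderiv ℝ (fun q' => w q' j) q (Pi.single k 1) * w q k) +
      (∑ j : Fin n,
        fderiv ℝ (fun x => fderiv ℝ L x (0, Pi.single i 1)) (q, w q) (Pi.single j 1, 0) *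
          w q j) -
      fderiv ℝ L (q, w q) (Pi.single i 1, 0) = 0) := by
  have hg : ∀ i : Fin n,
      Differentiable ℝ (fun x => fderiv ℝ L x (0, Pi.single i 1)) := by
    intro i
    have h1 : ContDiff ℝ 1 (fderiv ℝ L) := hL.fderiv_right (by norm_num)
    exact (h1.clm_apply contDiff_const).differentiable (by norm_num)
  have hwd : Differentiable ℝ w := hw.differentiable (by norm_num)
  have key : ∀ (γ : ℝ → (Fin n → ℝ)) (t : ℝ) (i : Fin n), HasDerivAt γ (w (γ t)) t →
      HasDerivAt (fun s => fderiv ℝ L (γ s, w (γ s)) (0, Pi.single i 1))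
        ((∑ j : Fin n, ∑ k : Fin n,
          fderiv ℝ (fun x => fderiv ℝ L x (0, Pi.single i 1)) (γ t, w (γ t))
            (0, Pi.single j 1) *
            fderiv ℝ (fun q' => w q' j) (γ t) (Pi.single k 1) * w (γ t) k) +
        (∑ j : Fin n,
          fderiv ℝ (fun x => fderiv ℝ L x (0, Pi.single i 1)) (γ t, w (γ t))
            (Pi.single j 1, 0) * w (γ t) j)) t := by
    intro γ t i h
    have h2 : HasDerivAt (fun s => w (γ s)) (fderiv ℝ w (γ t) (w (γ t))) t :=
      (hwd (γ t)).hasFDerivAt.comp_hasDerivAt t h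
    have h3 := (hg i (γ t, w (γ t))).hasFDerivAt.comp_hasDerivAt_of_eq t (h.prodMk h2) rfl
    refine h3.congr_deriv ?_
    rw [lin_expand_prod]
    congr 1
    refine Finset.sum_congr rfl fun j _ => ?_
    have h4 : fderiv ℝ w (γ t) (w (γ t)) j = fderiv ℝ (fun q' => w q' j) (γ t) (w (γ t)) := by
      have h5 := (hasFDerivAt_pi'.1 (hwd (γ t)).hasFDerivAt j).fderiv
      rw [h5]
      rfl
    rw [h4, lin_expand, Finset.mul_sum]
    exact Finset.sum_congr rfl fun k _ => (mul_assoc _ _ _).symm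
  constructor
  · intro H q i
    obtain ⟨γ, ε, hε, h0, hγ⟩ := hexist q
    have ht : (0 : ℝ) ∈ Set.Ioo (-ε) ε := ⟨by linarith, hε⟩
    have h := (key γ 0 i (hγ 0 ht)).unique (H γ _ _ hγ 0 ht i)
    rw [h0] at h
    exact sub_eq_zero.2 h
  · intro H γ c d hγ t ht i
    exact (key γ t i (hγ t ht)).congr_deriv (sub_eq_zero.1 (H (γ t) i))
end

section
/- Let L : ℝⁿ × ℝⁿ → ℝ be twice continuously differentiable and w : ℝⁿ → ℝⁿ continuously differentiable. Assume: (a) for every q ∈ ℝⁿ and every i, Σ_{j,k} (∂²L/∂v^i∂v^j)(q, w(q)) · (∂w^j/∂q^k)(q) · w^k(q) + Σ_j (∂²L/∂v^i∂q^j)(q, w(q)) · w^j(q) − (∂L/∂q^i)(q, w(q)) = 0 (the generalized Lagrangian Hamilton–Jacobi equation); and (b) the 1-form with components p_i(q) = (∂L/∂v^i)(q, w(q)) is closed, i.e. ∂p_i/∂q^j = ∂p_j/∂q^i for all i, j and all q. Then the pulled-back energy function q ↦ Σ_i w^i(q) · (∂L/∂v^i)(q, w(q)) − L(q, w(q)) has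 zero derivative at every point of ℝⁿ (hence is locally constant). -/
open Set

theorem clm_pi_expand {n : ℕ} (A : (Fin n → ℝ) →L[ℝ] ℝ) (v : Fin n → ℝ) :
    A v = ∑ j : Fin n, A (Pi.single j 1) * v j := by
  conv_lhs => rw [pi_eq_sum_univ' v]
  simp only [map_sum, map_smul, smul_eq_mul]
  refine Finset.sum_congr rfl fun j _ => ?_
  rw [mul_comm]

theorem clm_prod_expand {n : ℕ} (A : (Fin n → ℝ) × (Fin n → ℝ) →L[ℝ] ℝ) (u v : Fin n → ℝ) :
    A (u, v) = (∑ j : Fin n, A (Pi.single j 1, 0) * u j) +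
      ∑ j : Fin n, A (0, Pi.single j 1) * v j := by
  have h1 := clm_pi_expand (A.comp (ContinuousLinearMap.inl ℝ _ _)) u
  have h2 := clm_pi_expand (A.comp (ContinuousLinearMap.inr ℝ _ _)) v
  simp only [ContinuousLinearMap.comp_apply, ContinuousLinearMap.inl_apply,
    ContinuousLinearMap.inr_apply] at h1 h2
  rw [← h1, ← h2, ← map_add]
  simp

/-- Let `L : ℝⁿ × ℝⁿ → ℝ` be `C²` and `w : ℝⁿ → ℝⁿ` be `C¹`. Assume
(a) the generalized Lagrangian Hamilton–Jacobi equation holds, and (b) the 1-form with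
components `pᵢ(q) = (∂L/∂vⁱ)(q, w(q))` is closed. Then the pulled-back energy
`q ↦ Σ_i wⁱ(q)·(∂L/∂vⁱ)(q, w(q)) − L(q, w(q))` has zero derivative everywhere
(hence is locally constant): if `X` solves the Lagrangian Hamilton–Jacobi problem then
`d(X*E_L) = 0`. -/
theorem stmt10 {n : ℕ}
    (L : (Fin n → ℝ) × (Fin n → ℝ) → ℝ) (hL : ContDiff ℝ 2 L)
    (w : (Fin n → ℝ) → (Fin n → ℝ)) (hw : ContDiff ℝ 1 w)
    -- (a) the generalized Lagrangian Hamilton–Jacobi equation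
    (hHJ : ∀ (q : Fin n → ℝ) (i : Fin n),
      (∑ j : Fin n, ∑ k : Fin n,
        fderiv ℝ (fun x => fderiv ℝ L x (0, Pi.single i 1)) (q, w q) (0, Pi.single j 1) *
          fderiv ℝ (fun q' => w q' j) q (Pi.single k 1) * w q k) +
      (∑ j : Fin n,
        fderiv ℝ (fun x => fderiv ℝ L x (0, Pi.single i 1)) (q, w q) (Pi.single j 1, 0) *
          w q j) -
      fderiv ℝ L (q, w q) (Pi.single i 1, 0) = 0)
    -- (b) the 1-form `pᵢ(q) = (∂L/∂vⁱ)(q, w(q))` is closed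
    (hclosed : ∀ (q : Fin n → ℝ) (i j : Fin n),
      fderiv ℝ (fun q' => fderiv ℝ L (q', w q') (0, Pi.single i 1)) q (Pi.single j 1) =
        fderiv ℝ (fun q' => fderiv ℝ L (q', w q') (0, Pi.single j 1)) q (Pi.single i 1)) :
    ∀ q : Fin n → ℝ,
      fderiv ℝ (fun q' =>
        (∑ i : Fin n, w q' i * fderiv ℝ L (q', w q') (0, Pi.single i 1)) - L (q', w q')) q
        = 0 := by
  intro q
  have hWd : HasFDerivAt w (fderiv ℝ w q) q :=
    ((hw.differentiable one_ne_zero) q).hasFDerivAt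
  set W := fderiv ℝ w q with hW
  have hg : HasFDerivAt (fun q' => (q', w q')) ((ContinuousLinearMap.id ℝ _).prod W) q :=
    (hasFDerivAt_id q).prodMk hWd
  have hwi : ∀ i, HasFDerivAt (fun q' => w q' i)
      ((ContinuousLinearMap.proj (R := ℝ) (φ := fun _ : Fin n => ℝ) i).comp W) q := fun i =>
    (hasFDerivAt_pi'.1 hWd) i
  have hLd : HasFDerivAt (fun q' => L (q', w q'))
      ((fderiv ℝ L (q, w q)).comp ((ContinuousLinearMap.id ℝ _).prod W)) q :=
    HasFDerivAt.comp (f := fun q' => (q', w q')) q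
      ((hL.differentiable two_ne_zero) (q, w q)).hasFDerivAt hg
  have hDL : ContDiff ℝ 1 (fderiv ℝ L) := hL.fderiv_right (by norm_num)
  have hPd : ∀ i : Fin n, Differentiable ℝ
      (fun x => fderiv ℝ L x ((0 : Fin n → ℝ), (Pi.single i 1 : Fin n → ℝ))) := fun i =>
    (hDL.clm_apply contDiff_const).differentiable one_ne_zero
  have hp : ∀ i : Fin n, HasFDerivAt
      (fun q' => fderiv ℝ L (q', w q') ((0 : Fin n → ℝ), (Pi.single i 1 : Fin n → ℝ)))
      ((fderiv ℝ (fun x => fderiv ℝ L x ((0 : Fin n → ℝ), (Pi.single i 1 : Fin n → ℝ)))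
        (q, w q)).comp ((ContinuousLinearMap.id ℝ _).prod W)) q := fun i =>
    HasFDerivAt.comp (f := fun q' => (q', w q')) q (hPd i (q, w q)).hasFDerivAt hg
  have hE := (HasFDerivAt.fun_sum (u := Finset.univ)
    (fun i _ => (hwi i).mul (hp i))).sub hLd
  -- the key identity
  have key : ∀ k : Fin n, ∑ i : Fin n, w q i *
      fderiv ℝ (fun q' => fderiv ℝ L (q', w q') ((0 : Fin n → ℝ), (Pi.single i 1 : Fin n → ℝ)))
        q (Pi.single k 1) = fderiv ℝ L (q, w q) (Pi.single k 1, 0) := by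
    intro k
    have h1 := clm_pi_expand (fderiv ℝ (fun q' => fderiv ℝ L (q', w q')
      ((0 : Fin n → ℝ), (Pi.single k 1 : Fin n → ℝ))) q) (w q)
    have h2 : ∀ j, W (w q) j
        = ∑ k : Fin n, fderiv ℝ (fun q' => w q' j) q (Pi.single k 1) * w q k := by
      intro j
      rw [(hwi j).fderiv]
      exact clm_pi_expand
        ((ContinuousLinearMap.proj (R := ℝ) (φ := fun _ : Fin n => ℝ) j).comp W) (w q)
    have h3 := hHJ q k
    calc _ = ∑ i : Fin n, fderiv ℝ (fun q' => fderiv ℝ L (q', w q')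
              ((0 : Fin n → ℝ), (Pi.single k 1 : Fin n → ℝ))) q (Pi.single i 1) * w q i :=
          Finset.sum_congr rfl fun i _ => by rw [hclosed q i k, mul_comm]
      _ = _ := by
          rw [← h1, (hp k).fderiv]
          simp only [ContinuousLinearMap.comp_apply, ContinuousLinearMap.prod_apply,
            ContinuousLinearMap.id_apply]
          rw [clm_prod_expand]
          simp only [h2, Finset.mul_sum, ← mul_assoc]
          linarith
  refine hE.fderiv.trans ?_
  ext v
  rw [clm_pi_expand _ v]
  refine Finset.sum_eq_zero fun k _ => ?_
  have hk := key k
  simp only [(hp _).fderiv] at hk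
  have h4 := clm_prod_expand (fderiv ℝ L (q, w q)) (Pi.single k 1) (W (Pi.single k 1))
  have h5 := clm_prod_expand (fderiv ℝ L (q, w q)) (Pi.single k 1) 0
  simp only [Pi.zero_apply, mul_zero, Finset.sum_const_zero, add_zero] at h5
  rw [← h5] at h4
  rw [mul_eq_zero]
  left
  simp only [ContinuousLinearMap.comp_apply, ContinuousLinearMap.prod_apply,
    ContinuousLinearMap.id_apply] at hk
  simp only [ContinuousLinearMap.sub_apply, ContinuousLinearMap.sum_apply,
    ContinuousLinearMap.add_apply, ContinuousLinearMap.smul_apply, smul_eq_mul,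
    ContinuousLinearMap.comp_apply, ContinuousLinearMap.prod_apply,
    ContinuousLinearMap.id_apply, ContinuousLinearMap.proj_apply, Finset.sum_add_distrib]
  rw [hk, h4]
  ring
end

section
/- Let E be a finite-dimensional real inner product space and X : E → E a continuously differentiable map (vector field) with X(q) ≠ 0 for every q; set X̂(q) = X(q)/‖X(q)‖. Then the 1-form X̂^♭ : q ↦ ⟨X̂(q), ·⟩ is closed — i.e. ⟨DX̂(q)u, v⟩ = ⟨DX̂(q)v, u⟩ for all q ∈ E and u, v ∈ E, where DX̂(q) is the Fréchet derivative of X̂ at q — if and only if the following two conditions hold: (1) for all continuously differentiable vector fields Y, Z : E → E satisfying ⟨Y(q), X(q)⟩ = 0 and ⟨Z(q), X(q)⟩ = 0 for all q, one has ⟨X(q), [Y, Z](q)⟩ = 0 for all q, where [Y, Z](q) = DZ(q)(Y(q)) − DY(q)(Z(q)) is the Lie bracket (the orthogonal distribution X^⊥ is involutive); and (2) there exists λ : E → ℝ such that DX(q)(X(q)) = λ(q) · X(q) for every q. -/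
open scoped RealInnerProductSpace

theorem aux_inner {E : Type*} [NormedAddCommGroup E] [InnerProductSpace ℝ E]
    (Y N : E → E) (c : ℝ) (q u : E) (hY : DifferentiableAt ℝ Y q) (hN : DifferentiableAt ℝ N q)
    (h : ∀ p, ⟪Y p, N p⟫ = c) :
    ⟪Y q, fderiv ℝ N q u⟫ + ⟪fderiv ℝ Y q u, N q⟫ = 0 := by
  rw [← fderiv_inner_apply ℝ hY hN u]
  have : (fun t => ⟪Y t, N t⟫) = fun _ => c := funext h
  rw [this]
  simp

/-- Let `E` be a finite-dimensional real inner product space and `X : E → E`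
a `C¹` nowhere-vanishing vector field; set `X̂(q) = X(q)/‖X(q)‖`. Then the 1-form `X̂^♭` is
closed (i.e. `⟨DX̂(q)u, v⟩ = ⟨DX̂(q)v, u⟩` for all `q, u, v`) if and only if:
(1) the orthogonal distribution `X^⊥` is involutive: for all `C¹` vector fields `Y, Z`
everywhere orthogonal to `X`, `⟨X(q), [Y,Z](q)⟩ = 0` for all `q`, where
`[Y,Z](q) = DZ(q)(Y(q)) − DY(q)(Z(q))`; and
(2) `DX(q)(X(q)) = λ(q)·X(q)` for some function `λ : E → ℝ`. -/
theorem stmt14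
    {E : Type*} [NormedAddCommGroup E] [InnerProductSpace ℝ E] [FiniteDimensional ℝ E]
    (X : E → E) (hX : ContDiff ℝ 1 X) (hX0 : ∀ q : E, X q ≠ 0)
    (Xhat : E → E) (hXhat : ∀ q : E, Xhat q = ‖X q‖⁻¹ • X q) :
    (∀ (q u v : E), ⟪fderiv ℝ Xhat q u, v⟫ = ⟪fderiv ℝ Xhat q v, u⟫)
      ↔
    ((∀ Y Z : E → E, ContDiff ℝ 1 Y → ContDiff ℝ 1 Z →
        (∀ q : E, ⟪Y q, X q⟫ = 0) → (∀ q : E, ⟪Z q, X q⟫ = 0) →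
        ∀ q : E, ⟪X q, fderiv ℝ Z q (Y q) - fderiv ℝ Y q (Z q)⟫ = 0)
      ∧
      (∃ lam : E → ℝ, ∀ q : E, fderiv ℝ X q (X q) = lam q • X q)) := by
  have hr0 : ∀ q, ‖X q‖ ≠ 0 := fun q => norm_ne_zero_iff.mpr (hX0 q)
  have hrC : ContDiff ℝ 1 (fun q => ‖X q‖) := hX.norm ℝ hX0
  have hNC : ContDiff ℝ 1 Xhat := by
    have : Xhat = fun q => ‖X q‖⁻¹ • X q := funext hXhat
    rw [this]
    exact (hrC.inv hr0).smul hX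
  have hd : ∀ {Y : E → E}, ContDiff ℝ 1 Y → ∀ q, DifferentiableAt ℝ Y q :=
    fun h q => (h.differentiable one_ne_zero) q
  have hXN : ∀ q, X q = ‖X q‖ • Xhat q := by
    intro q
    rw [hXhat, smul_smul, mul_inv_cancel₀ (hr0 q), one_smul]
  have hNN : ∀ q, ⟪Xhat q, Xhat q⟫ = (1 : ℝ) := by
    intro q
    rw [hXhat, real_inner_self_eq_norm_sq, norm_smul, norm_inv, norm_norm,
      inv_mul_cancel₀ (hr0 q), one_pow]
  have hAN : ∀ q u, ⟪fderiv ℝ Xhat q u, Xhat q⟫ = (0 : ℝ) := by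
    intro q u
    have h := aux_inner Xhat Xhat 1 q u (hd hNC q) (hd hNC q) hNN
    rw [real_inner_comm (fderiv ℝ Xhat q u) (Xhat q)] at h
    rw [real_inner_comm] at h ⊢
    linarith
  have hDX : ∀ q u, fderiv ℝ X q u =
      ‖X q‖ • fderiv ℝ Xhat q u + (fderiv ℝ (fun q => ‖X q‖) q u) • Xhat q := by
    intro q u
    have e : X = fun q => ‖X q‖ • Xhat q := funext hXN
    have h1 := (((hrC.differentiable one_ne_zero) q).hasFDerivAt.smul (hd hNC q).hasFDerivAt).fderiv
    have h2 : fderiv ℝ X q = fderiv ℝ (fun q => ‖X q‖ • Xhat q) q := congrArg (fderiv ℝ · q) e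
    rw [h2]
    erw [h1]
    simp
  have hbr : ∀ Y Z : E → E, ContDiff ℝ 1 Y → ContDiff ℝ 1 Z →
        (∀ q : E, ⟪Y q, X q⟫ = 0) → (∀ q : E, ⟪Z q, X q⟫ = 0) →
        ∀ q : E, ⟪X q, fderiv ℝ Z q (Y q) - fderiv ℝ Y q (Z q)⟫ =
          ‖X q‖ * (⟪fderiv ℝ Xhat q (Z q), Y q⟫ - ⟪fderiv ℝ Xhat q (Y q), Z q⟫) := by
    intro Y Z hY hZ hYX hZX q
    have hYN : ∀ p, ⟪Y p, Xhat p⟫ = (0 : ℝ) := fun p => by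
      rw [hXhat, inner_smul_right, hYX, mul_zero]
    have hZN : ∀ p, ⟪Z p, Xhat p⟫ = (0 : ℝ) := fun p => by
      rw [hXhat, inner_smul_right, hZX, mul_zero]
    have h1 := aux_inner Y Xhat 0 q (Z q) (hd hY q) (hd hNC q) hYN
    have h2 := aux_inner Z Xhat 0 q (Y q) (hd hZ q) (hd hNC q) hZN
    have h3 : ⟪X q, fderiv ℝ Z q (Y q) - fderiv ℝ Y q (Z q)⟫ =
        ‖X q‖ * (⟪fderiv ℝ Z q (Y q), Xhat q⟫ - ⟪fderiv ℝ Y q (Z q), Xhat q⟫) := by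
      conv_lhs => rw [hXN q]
      rw [real_inner_smul_left, inner_sub_right, real_inner_comm (Xhat q),
        real_inner_comm (Xhat q)]
    rw [h3, real_inner_comm (Y q), real_inner_comm (Z q)]
    congr 1
    linarith
  constructor
  · intro hsym
    refine ⟨?_, ?_⟩
    · intro Y Z hY hZ hYX hZX q
      rw [hbr Y Z hY hZ hYX hZX q, hsym q (Z q) (Y q), sub_self, mul_zero]
    · refine ⟨fun q => ‖X q‖⁻¹ * fderiv ℝ (fun q => ‖X q‖) q (X q), fun q => ?_⟩
      have h0 : fderiv ℝ Xhat q (Xhat q) = 0 := by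
        apply ext_inner_right ℝ
        intro v
        rw [hsym, hAN, inner_zero_left]
      have h1 : fderiv ℝ Xhat q (X q) = 0 := by
        rw [hXN q, map_smul, h0, smul_zero]
      rw [hDX, h1, smul_zero, zero_add, hXhat, smul_smul, mul_comm]
  · rintro ⟨hinv, lam, hlam⟩ q u v
    have h0 : fderiv ℝ Xhat q (Xhat q) = 0 := by
      have h1 := hlam q
      rw [hDX] at h1
      have h2 := congrArg (fun w => ⟪w, fderiv ℝ Xhat q (X q)⟫) h1
      have h3 : ⟪Xhat q, fderiv ℝ Xhat q (X q)⟫ = (0 : ℝ) := by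
        rw [real_inner_comm]; exact hAN q _
      have h4 : ⟪X q, fderiv ℝ Xhat q (X q)⟫ = (0 : ℝ) := by
        have : ∀ w, ⟪X q, w⟫ = ‖X q‖ * ⟪Xhat q, w⟫ := fun w => by
          conv_lhs => rw [hXN q]
          rw [real_inner_smul_left]
        rw [this, h3, mul_zero]
      simp only [inner_add_left, real_inner_smul_left, h3, h4, mul_zero, add_zero] at h2
      have h5 : fderiv ℝ Xhat q (X q) = 0 :=
        inner_self_eq_zero.mp ((mul_eq_zero.mp h2).resolve_left (hr0 q))
      rw [hXhat q, map_smul, h5, smul_zero]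
    have key : ∀ w : E, ContDiff ℝ 1 (fun p => w - ⟪w, Xhat p⟫ • Xhat p) ∧
        ∀ p, ⟪w - ⟪w, Xhat p⟫ • Xhat p, X p⟫ = 0 := by
      intro w
      refine ⟨contDiff_const.sub ((contDiff_const.inner ℝ hNC).smul hNC), fun p => ?_⟩
      conv_lhs => rw [hXN p]
      rw [real_inner_smul_right, inner_sub_left, real_inner_smul_left, hNN, mul_one, sub_self,
        mul_zero]
    have h := hinv _ _ (key u).1 (key v).1 (key u).2 (key v).2 q
    rw [hbr _ _ (key u).1 (key v).1 (key u).2 (key v).2 q] at h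
    have h' := (mul_eq_zero.mp h).resolve_left (hr0 q)
    simp only [map_sub, map_smul, h0, smul_zero, sub_zero, inner_sub_right,
      real_inner_smul_right, hAN, mul_zero] at h'
    linarith
end

section
/- Let E be a finite-dimensional real inner product space and X : E → E a continuously differentiable map (vector field) with ‖X(q)‖ = 1 for every q. Then the 1-form X^♭ : q ↦ ⟨X(q), ·⟩ is closed — i.e. ⟨DX(q)u, v⟩ = ⟨DX(q)v, u⟩ for all q ∈ E and u, v ∈ E, where DX(q) is the Fréchet derivative of X at q — if and only if the following two conditions hold: (1) for all continuously differentiable vector fields Y, Z : E → E satisfying ⟨Y(q), X(q)⟩ = 0 and ⟨Z(q), X(q)⟩ = 0 for all q, one has ⟨X(q), [Y, Z](q)⟩ = 0 for all q, where [Y, Z](q) = DZ(q)(Y(q)) − DY(q)(Z(q)) is the Lie bracket (the orthogonal distribution X^⊥ is involutive); and (2) DX(q)(X(q)) = 0 for every q (X is a geodetic vector field). -/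
open scoped RealInnerProductSpace

theorem stmt15_aux {E : Type*} [NormedAddCommGroup E] [InnerProductSpace ℝ E]
    (A B : E → E) (hA : ContDiff ℝ 1 A) (hB : ContDiff ℝ 1 B) (c : ℝ)
    (h : ∀ q : E, inner ℝ (A q) (B q) = c) (q u : E) :
    inner ℝ (A q) (fderiv ℝ B q u) + inner ℝ (fderiv ℝ A q u) (B q) = 0 := by
  have h1 := fderiv_inner_apply ℝ (hA.differentiable one_ne_zero q)
    (hB.differentiable one_ne_zero q) u
  have h2 : (fun t => inner ℝ (A t) (B t)) = fun _ : E => c := funext h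
  rw [h2] at h1
  simpa using h1.symm

/-- Let `E` be a finite-dimensional real inner product space and `X : E → E`
a `C¹` unit vector field (`‖X(q)‖ = 1` for all `q`). Then the 1-form `X^♭` is closed
(i.e. `⟨DX(q)u, v⟩ = ⟨DX(q)v, u⟩` for all `q, u, v`) if and only if:
(1) the orthogonal distribution `X^⊥` is involutive: for all `C¹` vector fields `Y, Z`
everywhere orthogonal to `X`, `⟨X(q), [Y,Z](q)⟩ = 0` for all `q`, where
`[Y,Z](q) = DZ(q)(Y(q)) − DY(q)(Z(q))`; and
(2) `DX(q)(X(q)) = 0` for every `q` (`X` is a geodetic vector field). -/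
theorem stmt15
    {E : Type*} [NormedAddCommGroup E] [InnerProductSpace ℝ E] [FiniteDimensional ℝ E]
    (X : E → E) (hX : ContDiff ℝ 1 X) (hX1 : ∀ q : E, ‖X q‖ = 1) :
    (∀ (q u v : E), ⟪fderiv ℝ X q u, v⟫ = ⟪fderiv ℝ X q v, u⟫)
      ↔
    ((∀ Y Z : E → E, ContDiff ℝ 1 Y → ContDiff ℝ 1 Z →
        (∀ q : E, ⟪Y q, X q⟫ = 0) → (∀ q : E, ⟪Z q, X q⟫ = 0) →
        ∀ q : E, ⟪X q, fderiv ℝ Z q (Y q) - fderiv ℝ Y q (Z q)⟫ = 0)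
      ∧
      (∀ q : E, fderiv ℝ X q (X q) = 0)) := by
  have hXX : ∀ q u : E, ⟪fderiv ℝ X q u, X q⟫ = 0 := by
    intro q u
    have h := stmt15_aux X X hX hX 1 (fun q => by
      rw [real_inner_self_eq_norm_sq, hX1]; norm_num) q u
    rw [real_inner_comm] at h
    linarith
  constructor
  · intro hc
    refine ⟨?_, ?_⟩
    · intro Y Z hY hZ hYX hZX q
      have h1 := stmt15_aux Y X hY hX 0 hYX q (Z q)
      have h2 := stmt15_aux Z X hZ hX 0 hZX q (Y q)
      have h3 := hc q (Y q) (Z q)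
      rw [inner_sub_right, real_inner_comm (fderiv ℝ Z q (Y q)),
        real_inner_comm (fderiv ℝ Y q (Z q))]
      rw [real_inner_comm] at h1 h2
      linarith
    · intro q
      apply ext_inner_right ℝ
      intro v
      rw [hc, hXX, inner_zero_left]
  · rintro ⟨hi, hg⟩ q u v
    have hC : ∀ w : E, ContDiff ℝ 1 (fun p => w - ⟪w, X p⟫ • X p) := fun w =>
      contDiff_const.sub ((contDiff_const.inner ℝ hX).smul hX)
    have hO : ∀ w p : E, ⟪w - ⟪w, X p⟫ • X p, X p⟫ = 0 := by
      intro w p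
      rw [inner_sub_left, real_inner_smul_left, real_inner_self_eq_norm_sq, hX1]
      ring
    have h0 := hi _ _ (hC u) (hC v) (hO u) (hO v) q
    have h1 := stmt15_aux _ X (hC u) hX 0 (hO u) q (v - ⟪v, X q⟫ • X q)
    have h2 := stmt15_aux _ X (hC v) hX 0 (hO v) q (u - ⟪u, X q⟫ • X q)
    rw [inner_sub_right, real_inner_comm _ (X q), real_inner_comm _ (X q)] at h0
    have h3 : ∀ a b : E, ⟪a - ⟪a, X q⟫ • X q, fderiv ℝ X q (b - ⟪b, X q⟫ • X q)⟫
        = ⟪fderiv ℝ X q b, a⟫ := by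
      intro a b
      rw [map_sub, map_smul, hg, smul_zero, sub_zero, real_inner_comm, inner_sub_right,
        real_inner_smul_right, hXX, mul_zero, sub_zero]
    rw [h3] at h1 h2
    linarith
end

section
/- Fix m ∈ ℕ and a matrix ξ ∈ M_m(ℝ). Let U ⊂ M_m(ℝ) be the open set of invertible matrices and define α : U → M_m(ℝ)* by α(g)(v) = Tr(ξ · g⁻¹ · v). Then for every g ∈ U and every ζ ∈ M_m(ℝ), (Dα(g)(gξ))(gζ) − (Dα(g)(gζ))(gξ) = 0, where Dα(g) is the Fréchet derivative of α at g. That is, the contraction i_X(X*ω_L) of the pulled-back Lagrangian 2-form with the left-invariant vector field X(g) = gξ vanishes identically, so every left-invariant vector field on GL(m, ℝ) is a solution of the generalized Hamilton–Jacobi problem for the free-motion Lagrangian, even though X*ω_L itself need not vanish. -/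
attribute [local instance] Matrix.normedAddCommGroup Matrix.normedSpace

/-- The 1-form `α(g)(v) = Tr(ξ·g⁻¹·v)`, the pull-back `X*θ_L` of the Cartan 1-form of the
free-motion Lagrangian `L(g, ġ) = ½Tr((g⁻¹ġ)²)` by the left-invariant vector field
`X(g) = gξ`, as a (continuous) linear functional on matrices. -/
noncomputable def pullbackForm {m : ℕ} (ξ g : Matrix (Fin m) (Fin m) ℝ) :
    Matrix (Fin m) (Fin m) ℝ →L[ℝ] ℝ :=
  LinearMap.toContinuousLinearMap
    { toFun := fun v => (ξ * g⁻¹ * v).trace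
      map_add' := by intro v w; simp [Matrix.mul_add, Matrix.trace_add]
      map_smul' := by intro c v; simp [Matrix.mul_smul, Matrix.trace_smul] }

theorem clm_curve_aux {E : Type*} [NormedAddCommGroup E] [NormedSpace ℝ E]
    (F : E → E →L[ℝ] ℝ) (g w u p : E) (c : ℝ) (hd : DifferentiableAt ℝ F g)
    (hc : ∀ᶠ t : ℝ in nhds 0, F (g + t • w) (u + t • p) = c) :
    fderiv ℝ F g w u = - F g p := by
  have hl (a b : E) : HasDerivAt (fun t : ℝ => a + t • b) b 0 := by
    simpa using ((hasDerivAt_id (0 : ℝ)).smul_const b).const_add a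
  have hA : HasDerivAt (fun t : ℝ => F (g + t • w)) (fderiv ℝ F g w) 0 := by
    have h1 : HasFDerivAt F (fderiv ℝ F g) (g + (0 : ℝ) • w) := by
      simpa using hd.hasFDerivAt
    exact h1.comp_hasDerivAt (0 : ℝ) (hl g w)
  have hP := hA.clm_apply (hl u p)
  have hK : HasDerivAt (fun t : ℝ => F (g + t • w) (u + t • p)) 0 0 :=
    (hasDerivAt_const (0 : ℝ) c).congr_of_eventuallyEq hc
  have hU := hP.unique hK
  simp only [zero_smul, add_zero] at hU
  linarith

theorem pullbackForm_deriv_aux {m : ℕ} (ξ g w v : Matrix (Fin m) (Fin m) ℝ) (hg : IsUnit g)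
    (hd : DifferentiableAt ℝ (fun h => pullbackForm ξ h) g) :
    (fderiv ℝ (fun h => pullbackForm ξ h) g w) (g * v) = -(ξ * g⁻¹ * (w * v)).trace := by
  have hdet : ∀ᶠ t : ℝ in nhds 0, (g + t • w).det ≠ 0 := by
    have hcont : Continuous (fun t : ℝ => (g + t • w).det) := by
      apply Continuous.matrix_det
      fun_prop
    apply hcont.continuousAt.eventually_ne
    simpa using ((Matrix.isUnit_iff_isUnit_det g).1 hg).ne_zero
  refine clm_curve_aux (fun h => pullbackForm ξ h) g w (g * v) (w * v) (ξ * v).trace hd ?_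
  filter_upwards [hdet] with t ht
  have e : g * v + t • (w * v) = (g + t • w) * v := by
    rw [Matrix.add_mul, Matrix.smul_mul]
  change (ξ * (g + t • w)⁻¹ * (g * v + t • (w * v))).trace = _
  rw [e, Matrix.mul_assoc, Matrix.nonsing_inv_mul_cancel_left _ _ (isUnit_iff_ne_zero.2 ht)]

/-- For `ξ ∈ M_m(ℝ)` and `α : U → M_m(ℝ)*`, `α(g)(v) = Tr(ξ·g⁻¹·v)`, on
the open set `U` of invertible matrices, the contraction `i_X(X*ω_L)` of the pulled-back
Lagrangian 2-form with the left-invariant vector field `X(g) = gξ` vanishes identically: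
`(Dα(g)(gξ))(gζ) − (Dα(g)(gζ))(gξ) = 0` for all invertible `g` and all `ζ`. Hence every
left-invariant vector field on `GL(m, ℝ)` solves the generalized Hamilton–Jacobi problem for
the free-motion Lagrangian, even though `X*ω_L` itself need not vanish. -/
theorem stmt17 {m : ℕ} (ξ : Matrix (Fin m) (Fin m) ℝ) :
    ∀ g : Matrix (Fin m) (Fin m) ℝ, IsUnit g → ∀ ζ : Matrix (Fin m) (Fin m) ℝ,
      (fderiv ℝ (fun h => pullbackForm ξ h) g (g * ξ)) (g * ζ)
        - (fderiv ℝ (fun h => pullbackForm ξ h) g (g * ζ)) (g * ξ)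
        = 0 := by
  intro g hg ζ
  by_cases hd : DifferentiableAt ℝ (fun h => pullbackForm ξ h) g
  · have hu := (Matrix.isUnit_iff_isUnit_det g).1 hg
    rw [pullbackForm_deriv_aux ξ g _ _ hg hd, pullbackForm_deriv_aux ξ g _ _ hg hd]
    have e (a b : Matrix (Fin m) (Fin m) ℝ) : ξ * g⁻¹ * (g * a * b) = ξ * (a * b) := by
      rw [Matrix.mul_assoc g, Matrix.mul_assoc ξ, Matrix.nonsing_inv_mul_cancel_left _ _ hu]
    rw [e, e, Matrix.trace_mul_comm ξ (ζ * ξ), Matrix.mul_assoc, Matrix.trace_mul_comm ζ,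
      Matrix.mul_assoc, sub_self]
  · rw [fderiv_zero_of_not_differentiableAt hd]
    simp
end
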